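/- In the setting of the first exit time τ(y) (with f C²-smooth, F ∈ C⁴(M), closure of D_c compact in M, the transversality condition, continuous vector field v with dF[v] ≥ 0 on ∂D_c, and every solution x(t,y) with x(0,y)=y ∈ D_c, ẋ(0,y)=v(y) leaving D_c at first time τ(y)): if ỹ ∈ ∂D_c is a boundary point at which dF(ỹ)[v(ỹ)] > 0, then for y ∈ D_c near ỹ the first exit time satisfies τ(y) = ((c − F(y))/dF(y)[v(y)]) · (1 + λ(y)), where λ(y) → 0 as y → ỹ. -/

import Mathlib

open Set

noncomputable section

/-- `x, x'` form a solution of the second-order system `ẍ = f(t, x, ẋ)` on the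
time set `s`, with the curve staying in the domain `M`. -/
def IsSolOn {m : ℕ} (M : Set (EuclideanSpace ℝ (Fin m)))
    (f : ℝ → EuclideanSpace ℝ (Fin m) → EuclideanSpace ℝ (Fin m) → EuclideanSpace ℝ (Fin m))
    (x x' : ℝ → EuclideanSpace ℝ (Fin m)) (s : Set ℝ) : Prop :=
  ∀ t ∈ s, x t ∈ M ∧ HasDerivWithinAt x (x' t) s t ∧
    HasDerivWithinAt x' (f t (x t) (x' t)) s t

open Filter Topology

/-- A curve starting in the half ball stays in the ball for a short time if its speed is bounded
as long as it is in the ball. -/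
theorem norm_sub_lt_of_speed_lt {E : Type*} [NormedAddCommGroup E] [NormedSpace ℝ E]
    {z z' : ℝ → E} {z₀ : E} {r K δ : ℝ} (hδ : K * δ < r / 2) (hK : 0 < K)
    (hz : ∀ t ∈ Ici (0 : ℝ), HasDerivWithinAt z (z' t) (Ici 0) t)
    (hz0 : ‖z 0 - z₀‖ ≤ r / 2)
    (hbound : ∀ t ∈ Ico 0 δ, ‖z t - z₀‖ < r → ‖z' t‖ < K) :
    ∀ t ∈ Icc 0 δ, ‖z t - z₀‖ < r := by
  have lt_r : ∀ t ∈ Icc 0 δ, r / 2 + K * t < r := fun t ht => by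
    nlinarith [mul_le_mul_of_nonneg_left ht.2 hK.le]
  intro t ht
  refine lt_of_le_of_lt ?_ (lt_r t ht)
  refine image_norm_le_of_norm_deriv_right_lt_deriv_boundary' (f := fun s => z s - z₀) (f' := z')
    (B := fun s => r / 2 + K * s) (B' := fun _ => K) (a := 0) (b := δ) ?_ ?_ (by simpa using hz0)
    (by fun_prop) ?_ ?_ ht
  · exact fun s hs => (((hz s hs.1).continuousWithinAt).mono Icc_subset_Ici_self).sub
      continuousWithinAt_const
  · exact fun s hs => ((hz s hs.1).mono (Ici_subset_Ici.2 hs.1)).sub_const z₀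
  · intro s _
    simpa using (((hasDerivAt_id s).const_mul K).const_add (r / 2)).hasDerivWithinAt
  · intro s hs hsB
    exact hbound s hs (hsB ▸ lt_r s (Ico_subset_Icc_self hs))

/-- Solutions of `ẍ = f(t, x, ẋ)` with initial data close to `(y₀, v₀)` stay close to
`(y₀, v₀)` on a common short time interval. -/
theorem IsSolOn.exists_forall_norm_lt {m : ℕ} {M : Set (EuclideanSpace ℝ (Fin m))}
    {f : ℝ → EuclideanSpace ℝ (Fin m) → EuclideanSpace ℝ (Fin m) → EuclideanSpace ℝ (Fin m)}
    (hf : ContinuousOn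
      (fun p : ℝ × EuclideanSpace ℝ (Fin m) × EuclideanSpace ℝ (Fin m) => f p.1 p.2.1 p.2.2)
      (Ici 0 ×ˢ M ×ˢ univ))
    {y₀ : EuclideanSpace ℝ (Fin m)} (hy₀ : y₀ ∈ M) (v₀ : EuclideanSpace ℝ (Fin m))
    {r : ℝ} (hr : 0 < r) :
    ∃ δ > 0, ∃ ρ > 0, ∀ x x' : ℝ → EuclideanSpace ℝ (Fin m), IsSolOn M f x x' (Ici 0) →
      ‖(x 0, x' 0) - (y₀, v₀)‖ < ρ → ∀ t ∈ Icc 0 δ, ‖(x t, x' t) - (y₀, v₀)‖ < r := by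
  have hc := hf (0, y₀, v₀) ⟨self_mem_Ici, hy₀, mem_univ _⟩
  obtain ⟨η, hη, hball⟩ := Metric.mem_nhdsWithin_iff.1
    (hc.norm.eventually (gt_mem_nhds (lt_add_one ‖f 0 y₀ v₀‖)))
  have hρ : 0 < min r η := lt_min hr hη
  set ρ := min r η
  set K := max (‖f 0 y₀ v₀‖ + 1) (‖v₀‖ + ρ)
  have hK : 0 < K := lt_max_of_lt_left (by positivity)
  refine ⟨min (η / 2) (ρ / (4 * K)), by positivity, ρ / 2, by positivity, ?_⟩
  intro x x' hx h0 t ht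
  refine lt_of_lt_of_le ?_ (min_le_left r η)
  refine norm_sub_lt_of_speed_lt (z := fun t => (x t, x' t))
    (z' := fun t => (x' t, f t (x t) (x' t))) ?_ hK
    (fun s hs => (hx s hs).2.1.prodMk (hx s hs).2.2) h0.le ?_ t ht
  · calc K * min (η / 2) (ρ / (4 * K)) ≤ K * (ρ / (4 * K)) := by gcongr; exact min_le_right _ _
      _ = ρ / 4 := by field_simp
      _ < ρ / 2 := by linarith
  · intro s hs hsr
    have hsη : s < η := by linarith [hs.2.trans_le (min_le_left (η / 2) (ρ / (4 * K)))]
    have hf_lt : ‖f s (x s) (x' s)‖ < ‖f 0 y₀ v₀‖ + 1 := by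
      refine hball (a := (s, x s, x' s)) ⟨?_, hs.1, (hx s hs.1).1, mem_univ _⟩
      rw [mem_ball_iff_norm, Prod.mk_sub_mk, Prod.norm_mk]
      refine max_lt ?_ (hsr.trans_le (min_le_right _ _))
      simpa [abs_of_nonneg hs.1] using hsη
    have hx'_lt : ‖x' s‖ < ‖v₀‖ + ρ := by
      have h1 : ‖x' s - v₀‖ < ρ := (norm_snd_le ((x s, x' s) - (y₀, v₀))).trans_lt hsr
      linarith [norm_le_insert' (x' s) v₀]
    rw [Prod.norm_mk]
    exact max_lt (hx'_lt.trans_le (le_max_right _ _)) (hf_lt.trans_le (le_max_left _ _))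

/-- Asymptotics of the first exit time near a boundary point `y₀ ∈ ∂D_c` where
`dF(y₀)[v(y₀)] > 0`: for `y ∈ D_c` near `y₀`,
`τ(y) = ((c − F(y)) / dF(y)[v(y)]) (1 + λ(y))` with `λ(y) → 0` as `y → y₀`. -/
theorem exit_time_asymptotics {m : ℕ} (M : Set (EuclideanSpace ℝ (Fin m)))
    (hMopen : IsOpen M) (hMconn : IsConnected M)
    (f : ℝ → EuclideanSpace ℝ (Fin m) → EuclideanSpace ℝ (Fin m) → EuclideanSpace ℝ (Fin m))
    (hf : ContDiffOn ℝ 2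
      (fun p : ℝ × EuclideanSpace ℝ (Fin m) × EuclideanSpace ℝ (Fin m) => f p.1 p.2.1 p.2.2)
      (Ici 0 ×ˢ M ×ˢ univ))
    (F : EuclideanSpace ℝ (Fin m) → ℝ) (hF : ContDiffOn ℝ 4 F M) (c : ℝ)
    (Dc bDc : Set (EuclideanSpace ℝ (Fin m)))
    (hDc : Dc = {x ∈ M | F x < c}) (hbDc : bDc = {x ∈ M | F x = c})
    (h2 : IsCompact (closure Dc)) (h2' : closure Dc ⊆ M)
    -- transversality condition on the boundary
    (h3 : ∀ t ∈ Ici (0:ℝ), ∀ x ∈ bDc, ∀ ξ : EuclideanSpace ℝ (Fin m),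
      fderiv ℝ F x ξ = 0 →
      0 < fderiv ℝ F x (f t x ξ) + fderiv ℝ (fderiv ℝ F) x ξ ξ)
    -- the continuous vector field of initial velocities
    (v : EuclideanSpace ℝ (Fin m) → EuclideanSpace ℝ (Fin m)) (hv : ContinuousOn v M)
    (hvF : ∀ x ∈ bDc, 0 ≤ fderiv ℝ F x (v x))
    -- the family of solutions `x(t, y)` with `x(0, y) = y`, `ẋ(0, y) = v(y)`
    (X X' : EuclideanSpace ℝ (Fin m) → ℝ → EuclideanSpace ℝ (Fin m))
    (hX : ∀ y ∈ Dc, IsSolOn M f (X y) (X' y) (Ici 0) ∧ X y 0 = y ∧ X' y 0 = v y)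
    -- every solution leaves `D_c`; `τ y` is the first exit time
    (τ : EuclideanSpace ℝ (Fin m) → ℝ)
    (hτ : ∀ y ∈ Dc, 0 < τ y ∧ F (X y (τ y)) = c ∧ ∀ t ∈ Ico (0:ℝ) (τ y), X y t ∈ Dc)
    (y₀ : EuclideanSpace ℝ (Fin m)) (hy₀ : y₀ ∈ bDc)
    (hy₀v : 0 < fderiv ℝ F y₀ (v y₀)) :
    ∃ lam : EuclideanSpace ℝ (Fin m) → ℝ,
      Filter.Tendsto lam (nhdsWithin y₀ Dc) (nhds 0) ∧
      ∀ᶠ y in nhdsWithin y₀ Dc,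
        τ y = (c - F y) / fderiv ℝ F y (v y) * (1 + lam y) := by
  have hy₀M : y₀ ∈ M := by rw [hbDc] at hy₀; exact hy₀.1
  have hFy₀ : F y₀ = c := by rw [hbDc] at hy₀; exact hy₀.2
  have hDcM : ∀ y ∈ Dc, y ∈ M ∧ F y < c := fun y hy => by rw [hDc] at hy; exact hy
  have hdF : ∀ x ∈ M, HasFDerivAt F (fderiv ℝ F x) x := fun x hx =>
    ((hF.contDiffAt (hMopen.mem_nhds hx)).differentiableAt (by norm_num)).hasFDerivAt
  set a := fderiv ℝ F y₀ (v y₀)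
  have hdFcont : ContinuousAt (fderiv ℝ F) y₀ :=
    (hF.continuousOn_fderiv_of_isOpen hMopen (by norm_num)).continuousAt (hMopen.mem_nhds hy₀M)
  have hvcont : ContinuousAt v y₀ := hv.continuousAt (hMopen.mem_nhds hy₀M)
  have hpair : ContinuousAt (fun p : EuclideanSpace ℝ (Fin m) × EuclideanSpace ℝ (Fin m) =>
      fderiv ℝ F p.1 p.2) (y₀, v y₀) :=
    (hdFcont.comp (x := (y₀, v y₀)) (f := Prod.fst) continuousAt_fst).clm_apply continuousAt_snd
  have hd : Tendsto (fun y => fderiv ℝ F y (v y)) (𝓝[Dc] y₀) (𝓝 a) :=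
    (hdFcont.clm_apply hvcont).tendsto.mono_left nhdsWithin_le_nhds
  have hslope : ∀ y ∈ Dc, ∀ T > 0, ∃ s ∈ Ioo 0 T,
      fderiv ℝ F (X y s) (X' y s) = (F (X y T) - F y) / T := by
    intro y hy T hT
    obtain ⟨hsol, hX0, -⟩ := hX y hy
    have hderiv : ∀ t ∈ Ici (0 : ℝ), HasDerivWithinAt (fun t => F (X y t))
        (fderiv ℝ F (X y t) (X' y t)) (Ici 0) t := fun t ht =>
      (hdF _ (hsol t ht).1).comp_hasDerivWithinAt t (hsol t ht).2.1
    obtain ⟨s, hs, hse⟩ := exists_hasDerivAt_eq_slope (fun t => F (X y t))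
      (fun t => fderiv ℝ F (X y t) (X' y t)) hT
      (fun t ht => (hderiv t ht.1).continuousWithinAt.mono Icc_subset_Ici_self)
      (fun t ht => (hderiv t ht.1.le).hasDerivAt (Ici_mem_nhds ht.1))
    exact ⟨s, hs, by simpa [hX0] using hse⟩
  have hq : Tendsto (fun y => (c - F y) / τ y) (𝓝[Dc] y₀) (𝓝 a) := by
    rw [Metric.tendsto_nhds]
    intro ε hε
    obtain ⟨r, hr, hball⟩ := Metric.continuousAt_iff.1 hpair (min ε (a / 2)) (by positivity)
    obtain ⟨δ, hδ, ρ, hρ, hstay⟩ :=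
      IsSolOn.exists_forall_norm_lt hf.continuousOn hy₀M (v y₀) hr
    have hinit : ∀ᶠ y in 𝓝[Dc] y₀, ‖(y, v y) - (y₀, v y₀)‖ < ρ := by
      have h := (continuousAt_id.prodMk hvcont).eventually (Metric.ball_mem_nhds _ hρ)
      filter_upwards [nhdsWithin_le_nhds h] with y hy
      exact mem_ball_iff_norm.1 hy
    have hFclose : ∀ᶠ y in 𝓝[Dc] y₀, c - a / 2 * δ < F y := by
      refine nhdsWithin_le_nhds ((hdF y₀ hy₀M).continuousAt.eventually (lt_mem_nhds ?_))
      rw [hFy₀]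
      linarith [mul_pos (half_pos hy₀v) hδ]
    filter_upwards [hinit, hFclose, self_mem_nhdsWithin] with y hyi hyF hy
    obtain ⟨hsol, hX0, hX'0⟩ := hX y hy
    obtain ⟨hτpos, hτF, hτD⟩ := hτ y hy
    have hnear : ∀ t ∈ Icc 0 δ, |fderiv ℝ F (X y t) (X' y t) - a| < min ε (a / 2) := by
      intro t ht
      have h := hstay (X y) (X' y) hsol (by rwa [hX0, hX'0]) t ht
      exact hball (x := (X y t, X' y t)) (by rwa [dist_eq_norm])
    have hτδ : τ y ≤ δ := by
      by_contra! hlt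
      obtain ⟨s, hs, hse⟩ := hslope y hy δ hδ
      have h1 := (abs_lt.1 ((hnear s (Ioo_subset_Icc_self hs)).trans_le (min_le_right _ _))).1
      rw [hse] at h1
      have h2 : a / 2 < (F (X y δ) - F y) / δ := by linarith
      rw [lt_div_iff₀ hδ] at h2
      linarith [(hDcM _ (hτD δ ⟨hδ.le, hlt⟩)).2]
    obtain ⟨s, hs, hse⟩ := hslope y hy (τ y) hτpos
    rw [hτF] at hse
    rw [← hse, Real.dist_eq]
    exact (hnear s ⟨hs.1.le, hs.2.le.trans hτδ⟩).trans_le (min_le_left _ _)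
  refine ⟨fun y => fderiv ℝ F y (v y) / ((c - F y) / τ y) - 1, ?_, ?_⟩
  · simpa [div_self hy₀v.ne'] using (hd.div hq hy₀v.ne').sub_const 1
  · filter_upwards [hd.eventually (lt_mem_nhds hy₀v), self_mem_nhdsWithin] with y hdy hy
    have h1 : c - F y ≠ 0 := (sub_pos.2 (hDcM y hy).2).ne'
    have h2 := (hτ y hy).1.ne'
    have h3 := hdy.ne'
    field_simp
    ring
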